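/- Let a, b ∈ ℤ with b − a ≥ 3, and let ν ∈ ℝ with 1 < ν < 2. Assume b − a ≠ H_ν(b,a). Fix s ∈ ℕ_{a+3}^b and define u(t) := −H_ν(b, s−1)·(t − a − H_ν(t,a))/(b − a − H_ν(b,a)) for t ∈ ℕ_a^b. Then u satisfies ∇[t ↦ (∇_{a*}^ν u)(t)](t) = 0 for all t ∈ ℕ_{a+3}^b, together with the boundary conditions u(a) = 0, (∇u)(a+1) = 0, and u(b) = −H_ν(b, s−1). -/

import Mathlib

/-- Nabla (backward) difference: `∇f(t) = f(t) - f(t-1)`. -/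
noncomputable def nabla (f : ℤ → ℝ) : ℤ → ℝ := fun t => f t - f (t - 1)

/-- Nabla fractional Taylor monomial `H_ν(t,a)`, with convention `H_ν(a,a) = 0`. -/
noncomputable def Hmon (ν : ℝ) (t a : ℤ) : ℝ :=
  if t = a then 0
  else Real.Gamma ((t : ℝ) - (a : ℝ) + ν) / (Real.Gamma ((t : ℝ) - (a : ℝ)) * Real.Gamma (ν + 1))

/-- Nabla fractional integral of order `ν` based at `a`:
`(∇_a^{-ν} f)(t) = ∑_{s=a+1}^t H_{ν-1}(t, s-1) f(s)`. -/
noncomputable def fracSum (ν : ℝ) (a : ℤ) (f : ℤ → ℝ) (t : ℤ) : ℝ :=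
  ∑ s ∈ Finset.Icc (a + 1) t, Hmon (ν - 1) t (s - 1) * f s

/-- Nabla Caputo fractional difference of order `ν > 0` based at `a`, with `N = ⌈ν⌉`. -/
noncomputable def caputo (ν : ℝ) (a : ℤ) (f : ℤ → ℝ) (t : ℤ) : ℝ :=
  fracSum ((⌈ν⌉₊ : ℝ) - ν) a (nabla^[⌈ν⌉₊] f) t

/-- The operator `(L_a^ν x)(t) = ∇[p·(∇_{a*}^ν x)](t) + q(t)·x(t-1)`. -/
noncomputable def Lop (ν : ℝ) (a : ℤ) (p q x : ℤ → ℝ) (t : ℤ) : ℝ :=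
  nabla (fun τ => p τ * caputo ν a x τ) t + q t * x (t - 1)

theorem multichoose_add_eq {R : Type*} [CommRing R] [BinomialRing R] (r s : R) (n : ℕ) :
    Ring.multichoose (r + s) n =
      ∑ ij ∈ Finset.HasAntidiagonal.antidiagonal n, Ring.multichoose r ij.1 * Ring.multichoose s ij.2 := by
  have h := Ring.add_choose_eq n (Commute.all (-r) (-s))
  have hsum : ∑ ij ∈ Finset.HasAntidiagonal.antidiagonal n, Ring.choose (-r) ij.1 * Ring.choose (-s) ij.2 =
      Int.negOnePow n • ∑ ij ∈ Finset.HasAntidiagonal.antidiagonal n,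
        Ring.multichoose r ij.1 * Ring.multichoose s ij.2 := by
    rw [Finset.smul_sum]
    refine Finset.sum_congr rfl fun ij hij => ?_
    rw [Ring.choose_neg', Ring.choose_neg', smul_mul_smul_comm, ← Int.negOnePow_add,
      ← Finset.HasAntidiagonal.mem_antidiagonal.mp hij, Nat.cast_add]
  rw [hsum, ← neg_add, Ring.choose_neg'] at h
  exact smul_left_cancel _ h

theorem succ_mul_multichoose_succ (r : ℝ) (n : ℕ) :
    (n + 1) * Ring.multichoose r (n + 1) = (r + n) * Ring.multichoose r n := by
  have h₀ := Ring.factorial_nsmul_multichoose_eq_ascPochhammer r n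
  have h₁ := Ring.factorial_nsmul_multichoose_eq_ascPochhammer r (n + 1)
  rw [Polynomial.ascPochhammer_smeval_eq_eval, nsmul_eq_mul] at h₀ h₁
  rw [ascPochhammer_succ_eval, ← h₀, Nat.factorial_succ] at h₁
  have hn : (n.factorial : ℝ) ≠ 0 := by positivity
  push_cast at h₁
  apply mul_left_cancel₀ hn
  linear_combination h₁

theorem Gamma_add_nat_eq_multichoose {r : ℝ} (hr : 0 < r) (n : ℕ) :
    Real.Gamma (r + n) = Ring.multichoose r n * (n.factorial * Real.Gamma r) := by
  induction n with
  | zero => simp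
  | succ n ih =>
    have h : r + n ≠ 0 := by positivity
    rw [Nat.cast_succ, ← add_assoc, Real.Gamma_add_one h, ih, Nat.factorial_succ]
    push_cast
    linear_combination (-(n.factorial * Real.Gamma r)) * succ_mul_multichoose_succ r n

theorem Hmon_self (μ : ℝ) (a : ℤ) : Hmon μ a a = 0 := if_pos rfl

theorem Hmon_sub_one (μ : ℝ) (a : ℤ) : Hmon μ (a - 1) a = 0 := by
  have h : Real.Gamma (-1) = 0 := by simpa using Real.Gamma_neg_nat_eq_zero 1
  simp [Hmon, h]

theorem Hmon_eq_multichoose {μ : ℝ} (hμ : -1 < μ) (a : ℤ) (n : ℕ) :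
    Hmon μ (a + 1 + n) a = Ring.multichoose (μ + 1) n := by
  have hpos : 0 < μ + 1 := by linarith
  have hΓ := (Real.Gamma_pos_of_pos hpos).ne'
  have hn : (n.factorial : ℝ) ≠ 0 := by positivity
  rw [Hmon, if_neg (by omega)]
  push_cast
  rw [show (a : ℝ) + 1 + n - a + μ = μ + 1 + n by ring, show (a : ℝ) + 1 + n - a = n + 1 by ring,
    Gamma_add_nat_eq_multichoose hpos, Real.Gamma_nat_eq_factorial]
  field_simp

theorem nabla_Hmon {μ : ℝ} (hμ : 0 < μ) (a : ℤ) (n : ℕ) :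
    nabla (fun r => Hmon μ r a) (a + 1 + n) = Ring.multichoose μ n := by
  rw [nabla, Hmon_eq_multichoose (by linarith)]
  cases n with
  | zero => simp [Hmon_self]
  | succ n =>
    rw [show a + 1 + ((n + 1 : ℕ) : ℤ) - 1 = a + 1 + n by push_cast; ring,
      Hmon_eq_multichoose (by linarith), Ring.multichoose_succ_succ]
    ring

theorem nabla_nabla_Hmon {μ : ℝ} (hμ : 0 < μ) (a : ℤ) (n : ℕ) :
    nabla (nabla fun r => Hmon μ r a) (a + 1 + n) = Ring.multichoose (μ - 1) n := by
  rw [nabla, nabla_Hmon hμ]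
  cases n with
  | zero => simp [nabla, Hmon_self, Hmon_sub_one]
  | succ n =>
    have h := Ring.multichoose_succ_succ (μ - 1) n
    rw [sub_add_cancel] at h
    rw [show a + 1 + ((n + 1 : ℕ) : ℤ) - 1 = a + 1 + n by push_cast; ring, nabla_Hmon hμ, h]
    ring

theorem fracSum_eq_sum_antidiagonal {μ : ℝ} (hμ : 0 < μ) (a : ℤ) (f : ℤ → ℝ) (m : ℕ) :
    fracSum μ a f (a + 1 + m) =
      ∑ ij ∈ Finset.HasAntidiagonal.antidiagonal m, Ring.multichoose μ ij.1 * f (a + 1 + ij.2) := by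
  symm
  refine Finset.sum_bij' (fun ij _ => a + 1 + (ij.2 : ℤ))
    (fun r _ => ((a + 1 + m - r).toNat, (r - a - 1).toNat)) ?_ ?_ ?_ ?_ ?_
  · rintro ⟨i, j⟩ h
    simp only [Finset.HasAntidiagonal.mem_antidiagonal, Finset.mem_Icc] at h ⊢
    omega
  · intro r h
    simp only [Finset.HasAntidiagonal.mem_antidiagonal, Finset.mem_Icc] at h ⊢
    omega
  · rintro ⟨i, j⟩ h
    simp only [Finset.HasAntidiagonal.mem_antidiagonal, Prod.mk.injEq] at h ⊢
    omega
  · intro r h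
    simp only [Finset.mem_Icc] at h ⊢
    omega
  · rintro ⟨i, j⟩ h
    simp only [Finset.HasAntidiagonal.mem_antidiagonal] at h ⊢
    rw [show a + 1 + (m : ℤ) = a + 1 + (j : ℤ) - 1 + 1 + i by omega,
      Hmon_eq_multichoose (by linarith), sub_add_cancel]

theorem caputo_const_mul_sub_Hmon {ν : ℝ} (hν1 : 1 < ν) (hν2 : ν < 2) (a : ℤ) (c d : ℝ) (m : ℕ) :
    caputo ν a (fun r => c * (((r : ℝ) - a - Hmon ν r a) / d)) (a + 1 + m) = -(c / d) := by
  have hceil : ⌈ν⌉₊ = 2 := by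
    rw [Nat.ceil_eq_iff two_ne_zero]
    norm_num
    exact ⟨hν1, hν2.le⟩
  have hdiff (n : ℕ) : nabla^[2] (fun r => c * (((r : ℝ) - a - Hmon ν r a) / d)) (a + 1 + n) =
      -(c / d) * Ring.multichoose (ν - 1) n := by
    rw [← nabla_nabla_Hmon (by linarith) a n]
    simp only [Function.iterate_succ, Function.iterate_zero, Function.comp_apply, id, nabla]
    push_cast
    ring
  rw [caputo, hceil, Nat.cast_ofNat, fracSum_eq_sum_antidiagonal (by linarith)]
  simp_rw [hdiff, mul_left_comm _ (-(c / d))]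
  rw [← Finset.mul_sum, ← multichoose_add_eq, show 2 - ν + (ν - 1) = 1 by ring,
    Ring.multichoose_one, mul_one]

/-- The function `u(t,s)` for the (2,1) conjugate Green's function satisfies the
required boundary value problem. -/
theorem stmt11 (a b : ℤ) (hab : a + 3 ≤ b) (ν : ℝ) (hν1 : 1 < ν) (hν2 : ν < 2)
    (hb : ((b : ℝ) - (a : ℝ)) ≠ Hmon ν b a)
    (s : ℤ) (hs1 : a + 3 ≤ s) (hs2 : s ≤ b) :
    (∀ t : ℤ, a + 3 ≤ t → t ≤ b →
      nabla (fun τ => caputo ν a (fun r =>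
        -Hmon ν b (s - 1) * (((r : ℝ) - a - Hmon ν r a) / ((b : ℝ) - a - Hmon ν b a))) τ) t
        = 0) ∧
    (-Hmon ν b (s - 1) * (((a : ℝ) - a - Hmon ν a a) / ((b : ℝ) - a - Hmon ν b a)) = 0) ∧
    (nabla (fun r =>
      -Hmon ν b (s - 1) * (((r : ℝ) - a - Hmon ν r a) / ((b : ℝ) - a - Hmon ν b a)))
      (a + 1) = 0) ∧
    (-Hmon ν b (s - 1) * (((b : ℝ) - a - Hmon ν b a) / ((b : ℝ) - a - Hmon ν b a))
      = -Hmon ν b (s - 1)) := by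
  refine ⟨fun t ht _ => ?_, ?_, ?_, ?_⟩
  · obtain ⟨m, rfl⟩ : ∃ m : ℕ, t = a + 1 + (m + 1 : ℕ) := ⟨(t - a - 2).toNat, by omega⟩
    simp only [nabla]
    rw [show a + 1 + ((m + 1 : ℕ) : ℤ) - 1 = a + 1 + m by push_cast; ring,
      caputo_const_mul_sub_Hmon hν1 hν2, caputo_const_mul_sub_Hmon hν1 hν2, sub_self]
  · simp [Hmon_self]
  · have h := Hmon_eq_multichoose (show -1 < ν by linarith) a 0
    rw [Nat.cast_zero, add_zero, Ring.multichoose_zero_right] at h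
    simp [nabla, h, Hmon_self]
  · rw [div_self (sub_ne_zero.mpr hb), mul_one]
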